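/- Let Ω = [0,1]^d with |Ω| = 1 and α > 0. Let μ : [0,1] × Ω → ℝ be C¹ with μ ≥ 0, v : [0,1] × Ω → ℝ^d be C¹ with zero-flux boundary condition μ(t,x) v(t,x)·n(x) = 0 on the boundary of Ω, and f : [0,1] → ℝ continuous, satisfying the unnormalized continuity equation ∂_t μ(t,x) + ∇·(μ(t,x) v(t,x)) = f(t) on [0,1] × Ω; set μ₀ = μ(0,·), μ₁ = μ(1,·). Let Φ : [0,1] × Ω → ℝ be C¹ (C² in x) with ∇_x Φ(t,x)·n(x) = 0 on the boundary and satisfying the Hamilton–Jacobi inequality ∂_t Φ(t,x) + (1/2)‖∇_x Φ(t,x)‖² ≤ 0 for all (t,x). Then ∫₀¹ ∫_Ω (1/2)‖v(t,x)‖² μ(t,x) dx dt + (1/(2α)) ∫₀¹ f(t)² dt ≥ ∫_Ω Φ(1,x) μ₁(x) dx − ∫_Ω Φ(0,x) μ₀(x) dx − (α/2) ∫₀¹ (∫_Ω Φ(t,x) dx)² dt. -/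

import Mathlib

open MeasureTheory

/-- The unit cube `Ω = [0,1]^d` in `ℝ^d` (with `|Ω| = 1`). -/
def cube (d : ℕ) : Set (EuclideanSpace ℝ (Fin d)) :=
  {x | ∀ i, x i ∈ Set.Icc (0:ℝ) 1}

/-- The (spatial) divergence of a vector field `w` on `ℝ^d` at a point `x`. -/
noncomputable def diverg {d : ℕ}
    (w : EuclideanSpace ℝ (Fin d) → EuclideanSpace ℝ (Fin d))
    (x : EuclideanSpace ℝ (Fin d)) : ℝ :=
  ∑ i, fderiv ℝ w x (EuclideanSpace.single i 1) i

lemma cube_eq_preimage (d : ℕ) :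
    cube d = WithLp.ofLp ⁻¹' Set.Icc (0 : Fin d → ℝ) 1 := by
  ext x
  simp [cube, Set.mem_Icc, Pi.le_def, forall_and]

lemma isCompact_cube (d : ℕ) : IsCompact (cube d) := by
  rw [cube_eq_preimage]
  exact (EuclideanSpace.equiv (Fin d) ℝ).toHomeomorph.isCompact_preimage.2 isCompact_Icc

/-- The divergence theorem on the cube for a field with zero flux through the boundary. -/
lemma setIntegral_diverg_eq_zero {d : ℕ}
    {w : EuclideanSpace ℝ (Fin d) → EuclideanSpace ℝ (Fin d)} (hw : ContDiff ℝ 1 w)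
    (hflux : ∀ x ∈ cube d, ∀ i : Fin d, (x i = 0 ∨ x i = 1) → w x i = 0) :
    ∫ x in cube d, diverg w x = 0 := by
  cases d with
  | zero => simp [diverg]
  | succ n =>
    let L := EuclideanSpace.equiv (Fin (n + 1)) ℝ
    let f' : (Fin (n + 1) → ℝ) → (Fin (n + 1) → ℝ) →L[ℝ] (Fin (n + 1) → ℝ) := fun y =>
      L.toContinuousLinearMap ∘L fderiv ℝ w (L.symm y) ∘L L.symm.toContinuousLinearMap
    have hf' (y : Fin (n + 1) → ℝ) : HasFDerivAt (fun y => L (w (L.symm y))) (f' y) y :=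
      L.hasFDerivAt.comp y <| HasFDerivAt.comp y
        ((hw.differentiable one_ne_zero).differentiableAt.hasFDerivAt) L.symm.hasFDerivAt
    have hcont : Continuous f' :=
      continuous_const.clm_comp <|
        ((hw.continuous_fderiv one_ne_zero).comp L.symm.continuous).clm_comp continuous_const
    have hdiv : Continuous fun y => ∑ i, f' y (Pi.single i 1) i := by fun_prop
    have key := integral_divergence_of_hasFDerivAt_off_countable (0 : Fin (n + 1) → ℝ) 1
      zero_le_one (fun y => L (w (L.symm y))) f' ∅ Set.countable_empty
      (fun y _ => (hf' y).continuousAt.continuousWithinAt) (fun y _ => hf' y)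
      (hdiv.continuousOn.integrableOn_compact isCompact_Icc)
    have hface (i : Fin (n + 1)) (c : ℝ) (hc : c = 0 ∨ c = 1) :
        ∫ x in Set.Icc ((0 : Fin (n + 1) → ℝ) ∘ i.succAbove) ((1 : Fin (n + 1) → ℝ) ∘ i.succAbove),
          L (w (L.symm (i.insertNth c x))) i = 0 := by
      refine setIntegral_eq_zero_of_forall_eq_zero fun x hx => ?_
      refine hflux _ (fun j => ?_) i (by simpa [L] using hc)
      refine Fin.succAboveCases i ?_ (fun k => ?_) j
      · rcases hc with rfl | rfl <;> simp [L]
      · simpa [L] using And.intro (hx.1 k) (hx.2 k)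
    simp only [Pi.zero_apply, Pi.one_apply, hface _ _ (Or.inr rfl), hface _ _ (Or.inl rfl),
      sub_zero, Finset.sum_const_zero] at key
    rw [← key, cube_eq_preimage,
      ← (PiLp.volume_preserving_ofLp (Fin (n + 1))).setIntegral_preimage_emb
        (MeasurableEquiv.toLp 2 (Fin (n + 1) → ℝ)).symm.measurableEmbedding]
    rfl

lemma diverg_smul {d : ℕ} {φ : EuclideanSpace ℝ (Fin d) → ℝ}
    {w : EuclideanSpace ℝ (Fin d) → EuclideanSpace ℝ (Fin d)} {x : EuclideanSpace ℝ (Fin d)}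
    (hφ : DifferentiableAt ℝ φ x) (hw : DifferentiableAt ℝ w x) :
    diverg (fun y => φ y • w y) x = φ x * diverg w x + inner ℝ (gradient φ x) (w x) := by
  have hgrad : inner ℝ (gradient φ x) (w x) =
      ∑ i, fderiv ℝ φ x (EuclideanSpace.single i 1) * w x i := by
    rw [gradient, InnerProductSpace.toDual_symm_apply]
    conv_lhs => rw [← (EuclideanSpace.basisFun (Fin d) ℝ).sum_repr (w x)]
    simp [mul_comm]
  simp [diverg, fderiv_fun_smul hφ hw, hgrad, Finset.sum_add_distrib, Finset.mul_sum]

/-- The partial derivative in the first variable of a jointly `C¹` function is continuous. -/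
lemma ContDiff.continuous_deriv_fst {E F : Type*} [NormedAddCommGroup E] [NormedSpace ℝ E]
    [NormedAddCommGroup F] [NormedSpace ℝ F] {g : ℝ → E → F}
    (hg : ContDiff ℝ 1 fun p : ℝ × E => g p.1 p.2) :
    Continuous fun p : ℝ × E => deriv (fun s => g s p.2) p.1 := by
  have h (p : ℝ × E) : deriv (fun s => g s p.2) p.1 =
      fderiv ℝ (fun p : ℝ × E => g p.1 p.2) p (1, 0) :=
    (HasFDerivAt.comp_hasDerivAt (f := fun s => (s, p.2)) p.1
      (hg.differentiable one_ne_zero p).hasFDerivAt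
      ((hasDerivAt_id p.1).prodMk (hasDerivAt_const p.1 p.2))).deriv
  simp_rw [h]
  exact (hg.continuous_fderiv one_ne_zero).clm_apply continuous_const

/-- The fundamental theorem of calculus in the first variable, integrated over a compact set. -/
lemma ContDiff.intervalIntegral_setIntegral_deriv {E : Type*} [NormedAddCommGroup E]
    [NormedSpace ℝ E] [MeasurableSpace E] [BorelSpace E] [SecondCountableTopology E]
    {ν : Measure E} [SFinite ν] [IsFiniteMeasureOnCompacts ν] {K : Set E} (hK : IsCompact K)
    {g : ℝ → E → ℝ} (hg : ContDiff ℝ 1 fun p : ℝ × E => g p.1 p.2) (a b : ℝ) :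
    ∫ t in a..b, ∫ x in K, deriv (fun s => g s x) t ∂ν =
      (∫ x in K, g b x ∂ν) - ∫ x in K, g a x ∂ν := by
  have hD := hg.continuous_deriv_fst
  have hslice (t : ℝ) : IntegrableOn (g t) K ν :=
    (hg.continuous.comp (Continuous.prodMk_right t)).continuousOn.integrableOn_compact hK
  have hint : Integrable (Function.uncurry fun t x => deriv (fun s => g s x) t)
      ((volume.restrict (Set.uIoc a b)).prod (ν.restrict K)) := by
    rw [Measure.prod_restrict]
    exact (hD.continuousOn.integrableOn_compact (isCompact_uIcc.prod hK)).mono_set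
      (Set.prod_mono_left Set.uIoc_subset_uIcc)
  rw [intervalIntegral_integral_swap hint, ← integral_sub (hslice b) (hslice a)]
  refine integral_congr_ae (.of_forall fun x => ?_)
  have hx : ContDiff ℝ 1 fun s => g s x := hg.comp (contDiff_prodMk_left x)
  exact intervalIntegral.integral_deriv_eq_sub (fun t _ => hx.differentiable one_ne_zero t)
    ((hx.continuous_deriv le_rfl).intervalIntegrable a b)

/-- Weak duality for the L² unnormalized optimal transport on the unit
cube: for any feasible `(μ, v, f)` of the unnormalized continuity equation with zero-flux
boundary condition, and any dual potential `Φ` with Neumann boundary condition satisfying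
the Hamilton–Jacobi inequality `∂_t Φ + ½‖∇_x Φ‖² ≤ 0`, the primal cost dominates the
dual value. -/
theorem stmt12 {d : ℕ} (α : ℝ) (hα : 0 < α)
    (μ : ℝ → EuclideanSpace ℝ (Fin d) → ℝ)
    (v : ℝ → EuclideanSpace ℝ (Fin d) → EuclideanSpace ℝ (Fin d))
    (f : ℝ → ℝ)
    (Φ : ℝ → EuclideanSpace ℝ (Fin d) → ℝ)
    (hμ : ContDiff ℝ 1 (fun p : ℝ × EuclideanSpace ℝ (Fin d) => μ p.1 p.2))
    (hμnonneg : ∀ t ∈ Set.Icc (0:ℝ) 1, ∀ x ∈ cube d, 0 ≤ μ t x)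
    (hv : ContDiff ℝ 1 (fun p : ℝ × EuclideanSpace ℝ (Fin d) => v p.1 p.2))
    (hflux : ∀ t ∈ Set.Icc (0:ℝ) 1, ∀ x ∈ cube d, ∀ i : Fin d,
      (x i = 0 ∨ x i = 1) → μ t x * v t x i = 0)
    (hf : ContinuousOn f (Set.Icc 0 1))
    (hpde : ∀ t ∈ Set.Icc (0:ℝ) 1, ∀ x ∈ cube d,
      deriv (fun s => μ s x) t + diverg (fun y => μ t y • v t y) x = f t)
    (hΦ1 : ContDiff ℝ 1 (fun p : ℝ × EuclideanSpace ℝ (Fin d) => Φ p.1 p.2))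
    (hΦ2 : ∀ t ∈ Set.Icc (0:ℝ) 1, ContDiff ℝ 2 (Φ t))
    (hΦflux : ∀ t ∈ Set.Icc (0:ℝ) 1, ∀ x ∈ cube d, ∀ i : Fin d,
      (x i = 0 ∨ x i = 1) → gradient (Φ t) x i = 0)
    (hHJ : ∀ t ∈ Set.Icc (0:ℝ) 1, ∀ x ∈ cube d,
      deriv (fun s => Φ s x) t + (1/2) * ‖gradient (Φ t) x‖^2 ≤ 0) :
    (∫ x in cube d, Φ 1 x * μ 1 x) - (∫ x in cube d, Φ 0 x * μ 0 x)
        - (α/2) * ∫ t in (0:ℝ)..1, (∫ x in cube d, Φ t x)^2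
      ≤ (∫ t in (0:ℝ)..1, ∫ x in cube d, (1/2) * ‖v t x‖^2 * μ t x)
        + (1/(2*α)) * ∫ t in (0:ℝ)..1, (f t)^2 := by
  have hslice {g : ℝ → EuclideanSpace ℝ (Fin d) → ℝ}
      (hg : Continuous fun p : ℝ × EuclideanSpace ℝ (Fin d) => g p.1 p.2) (t : ℝ) :
      IntegrableOn (g t) (cube d) :=
    (hg.comp (Continuous.prodMk_right t)).continuousOn.integrableOn_compact (isCompact_cube d)
  have hparam {g : ℝ → EuclideanSpace ℝ (Fin d) → ℝ}
      (hg : Continuous fun p : ℝ × EuclideanSpace ℝ (Fin d) => g p.1 p.2) :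
      Continuous fun t => ∫ x in cube d, g t x :=
    continuous_parametric_integral_of_continuous hg (isCompact_cube d)
  have hΦμ : ContDiff ℝ 1 fun p : ℝ × EuclideanSpace ℝ (Fin d) => Φ p.1 p.2 * μ p.1 p.2 :=
    hΦ1.mul hμ
  have hD := ContDiff.continuous_deriv_fst (g := fun t x => Φ t x * μ t x) hΦμ
  have hcost : Continuous fun p : ℝ × EuclideanSpace ℝ (Fin d) =>
      (1/2) * ‖v p.1 p.2‖^2 * μ p.1 p.2 :=
    (continuous_const.mul (hv.continuous.norm.pow 2)).mul hμ.continuous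
  have hpoint (t : ℝ) (ht : t ∈ Set.Icc (0:ℝ) 1) :
      ∫ x in cube d, deriv (fun s => Φ s x * μ s x) t ≤
        (∫ x in cube d, (1/2) * ‖v t x‖^2 * μ t x) + f t * ∫ x in cube d, Φ t x := by
    have hΦt : ContDiff ℝ 1 (Φ t) := hΦ1.comp (contDiff_prodMk_right t)
    have hμt : ContDiff ℝ 1 (μ t) := hμ.comp (contDiff_prodMk_right t)
    have hvt : ContDiff ℝ 1 (v t) := hv.comp (contDiff_prodMk_right t)
    have hW : ContDiff ℝ 1 fun x => Φ t x • μ t x • v t x := hΦt.smul (hμt.smul hvt)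
    have hdivW : IntegrableOn (diverg fun x => Φ t x • μ t x • v t x) (cube d) := by
      have := hW.continuous_fderiv one_ne_zero
      refine ContinuousOn.integrableOn_compact (isCompact_cube d) (Continuous.continuousOn ?_)
      unfold diverg
      fun_prop
    have hzero : ∫ x in cube d, diverg (fun y => Φ t y • μ t y • v t y) x = 0 :=
      setIntegral_diverg_eq_zero hW fun x hx i hi => by
        simp [hflux t ht x hx i hi]
    have hcostt := hslice (g := fun t x => (1/2) * ‖v t x‖^2 * μ t x) hcost t
    have hfΦt : IntegrableOn (fun x => f t * Φ t x) (cube d) :=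
      (hslice hΦ1.continuous t).const_mul (f t)
    have hDt := hslice (g := fun t x => deriv (fun s => Φ s x * μ s x) t) hD t
    rw [← integral_const_mul, ← integral_add hcostt hfΦt,
      ← add_zero (∫ x in cube d, deriv (fun s => Φ s x * μ s x) t), ← hzero,
      ← integral_add hDt hdivW]
    refine setIntegral_mono_on (hDt.add hdivW) (hcostt.add hfΦt) (isCompact_cube d).measurableSet
      fun x hx => ?_
    have hderiv : deriv (fun s => Φ s x * μ s x) t =
        deriv (fun s => Φ s x) t * μ t x + Φ t x * deriv (fun s => μ s x) t :=
      deriv_fun_mul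
        ((hΦ1.comp (contDiff_prodMk_left x)).differentiable one_ne_zero t)
        ((hμ.comp (contDiff_prodMk_left x)).differentiable one_ne_zero t)
    rw [hderiv, diverg_smul (w := fun x => μ t x • v t x) (hΦt.differentiable one_ne_zero x)
      ((hμt.smul hvt).differentiable one_ne_zero x), real_inner_smul_right, ← hpde t ht x hx]
    have hyoung : inner ℝ (gradient (Φ t) x) (v t x) ≤
        (1/2) * ‖gradient (Φ t) x‖^2 + (1/2) * ‖v t x‖^2 := by
      nlinarith [norm_sub_sq_real (gradient (Φ t) x) (v t x),
        sq_nonneg ‖gradient (Φ t) x - v t x‖]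
    have := mul_nonneg (hμnonneg t ht x hx)
      (sub_nonneg.2 (add_le_add (hHJ t ht x hx) hyoung))
    linarith
  have hyoung (t : ℝ) : f t * ∫ x in cube d, Φ t x ≤
      (1/(2*α)) * (f t)^2 + (α/2) * (∫ x in cube d, Φ t x)^2 := by
    have : (1/(2*α)) * (f t)^2 + (α/2) * (∫ x in cube d, Φ t x)^2
        - f t * (∫ x in cube d, Φ t x) =
        (1/(2*α)) * (f t - α * ∫ x in cube d, Φ t x)^2 := by
      field_simp
      ring
    have : 0 ≤ (1/(2*α)) * (f t - α * ∫ x in cube d, Φ t x)^2 := by positivity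
    linarith
  have hcostInt : IntervalIntegrable (fun t => ∫ x in cube d, (1/2) * ‖v t x‖^2 * μ t x)
      volume 0 1 := (hparam (g := fun t x => (1/2) * ‖v t x‖^2 * μ t x) hcost).intervalIntegrable 0 1
  have hfInt : IntervalIntegrable (fun t => (1/(2*α)) * (f t)^2) volume 0 1 :=
    ((continuousOn_const.mul (hf.pow 2)).mono (by simp)).intervalIntegrable
  have hΦInt : IntervalIntegrable (fun t => (α/2) * (∫ x in cube d, Φ t x)^2) volume 0 1 :=
    (continuous_const.mul ((hparam hΦ1.continuous).pow 2)).intervalIntegrable 0 1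
  have hmono := intervalIntegral.integral_mono_on zero_le_one
    ((hparam (g := fun t x => deriv (fun s => Φ s x * μ s x) t) hD).intervalIntegrable 0 1) ((hcostInt.add hfInt).add hΦInt)
    fun t ht => by simpa only [add_assoc] using
      (hpoint t ht).trans (add_le_add_right (hyoung t) _)
  rw [ContDiff.intervalIntegral_setIntegral_deriv (isCompact_cube d)
      (g := fun t x => Φ t x * μ t x) hΦμ,
    intervalIntegral.integral_add (hcostInt.add hfInt) hΦInt,
    intervalIntegral.integral_add hcostInt hfInt,
    intervalIntegral.integral_const_mul, intervalIntegral.integral_const_mul] at hmono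
  linarith
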